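/- There are no analytic maximal almost disjoint families of infinite subsets of ω (Mathias's theorem, stated for this paper's context): if A is an analytic family of pairwise almost disjoint infinite subsets of ω with |A| ≥ ℵ₀, then A is not maximal almost disjoint. -/

import Mathlib

namespace MadAux

/-- Positive sets for the ideal generated by the family and the finite sets. -/
def Pos (A : Set (Set ℕ)) (X : Set ℕ) : Prop :=
  ∀ G : Set (Set ℕ), G ⊆ A → G.Finite → (X \ ⋃₀ G).Infinite

theorem Pos.almost {A : Set (Set ℕ)} {X Y : Set ℕ} (hX : Pos A X) (h : (X \ Y).Finite) :
    Pos A (X ∩ Y) := by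
  intro G hG hGf hfin
  refine hX G hG hGf ((hfin.union h).subset ?_)
  rintro n ⟨h1, h2⟩
  by_cases hn : n ∈ Y
  · exact Or.inl ⟨⟨h1, hn⟩, h2⟩
  · exact Or.inr ⟨h1, hn⟩

theorem Pos.mono {A : Set (Set ℕ)} {X Y : Set ℕ} (hX : Pos A X) (h : X ⊆ Y) : Pos A Y :=
  fun G hG hGf => (hX G hG hGf).mono (Set.sdiff_subset_sdiff_left h)

theorem Pos.union {A : Set (Set ℕ)} {X Y : Set ℕ} (h : Pos A (X ∪ Y)) : Pos A X ∨ Pos A Y := by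
  by_contra hc
  simp only [Pos, not_or, not_forall, Set.not_infinite] at hc
  obtain ⟨⟨G, hG, hGf, h1⟩, ⟨K, hK, hKf, h2⟩⟩ := hc
  refine h (G ∪ K) (Set.union_subset hG hK) (hGf.union hKf) ((h1.union h2).subset ?_)
  rintro n ⟨hn, hn2⟩
  rw [Set.sUnion_union] at hn2
  simp only [Set.mem_union, not_or] at hn2
  rcases hn with hn | hn
  · exact Or.inl ⟨hn, hn2.1⟩
  · exact Or.inr ⟨hn, hn2.2⟩

theorem finite_inter_sUnion {A : Set (Set ℕ)}
    (hAD : ∀ a ∈ A, ∀ b ∈ A, a ≠ b → (a ∩ b).Finite)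
    {G : Set (Set ℕ)} (hG : G ⊆ A) (hGf : G.Finite) {a : Set ℕ} (ha : a ∈ A) (haG : a ∉ G) :
    (a ∩ ⋃₀ G).Finite := by
  rw [Set.sUnion_eq_biUnion, Set.inter_iUnion₂]
  exact hGf.biUnion fun b hb => hAD a ha b (hG hb) (fun h => haG (h ▸ hb))

theorem diff_sUnion_infinite {A : Set (Set ℕ)}
    (hAD : ∀ a ∈ A, ∀ b ∈ A, a ≠ b → (a ∩ b).Finite)
    {G : Set (Set ℕ)} (hG : G ⊆ A) (hGf : G.Finite) {a P : Set ℕ} (ha : a ∈ A) (haG : a ∉ G)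
    (hP : P.Infinite) (hPa : P ⊆ a) : (P \ ⋃₀ G).Infinite := by
  intro hfin
  refine hP ((hfin.union (finite_inter_sUnion hAD hG hGf ha haG)).subset ?_)
  intro n hn
  by_cases h : n ∈ ⋃₀ G
  · exact Or.inr ⟨hPa hn, h⟩
  · exact Or.inl ⟨hn, h⟩

theorem pos_univ {A : Set (Set ℕ)}
    (hinf : ∀ a ∈ A, a.Infinite)
    (hAD : ∀ a ∈ A, ∀ b ∈ A, a ≠ b → (a ∩ b).Finite) (hbig : A.Infinite) :
    Pos A Set.univ := by
  intro G hG hGf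
  obtain ⟨a, ha, haG⟩ := hbig.exists_notMem_finite hGf
  exact (diff_sUnion_infinite hAD hG hGf ha haG (hinf a ha) subset_rfl).mono
    (Set.sdiff_subset_sdiff_left (Set.subset_univ _))

/-- Infinite pseudo-intersections. -/
theorem pseudo_inf (X : ℕ → Set ℕ) (hX : Antitone X) (hi : ∀ n, (X n).Infinite) :
    ∃ P : Set ℕ, P.Infinite ∧ P ⊆ X 0 ∧ ∀ n, (P \ X n).Finite := by
  choose p hp hlt using fun n => (hi n).exists_gt n
  refine ⟨Set.range p, ?_, ?_, ?_⟩
  · refine Set.infinite_of_not_bddAbove ?_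
    rintro ⟨m, hm⟩
    have := hm ⟨m, rfl⟩
    have := hlt m
    omega
  · rintro _ ⟨n, rfl⟩
    exact hX (Nat.zero_le n) (hp n)
  · intro n
    refine ((Set.finite_lt_nat n).image p).subset ?_
    rintro _ ⟨⟨i, rfl⟩, h⟩
    refine ⟨i, ?_, rfl⟩
    by_contra hc
    exact h (hX (not_lt.mp hc) (hp i))

/-- Positive pseudo-intersections. -/
theorem pseudo_pos {A : Set (Set ℕ)}
    (hAD : ∀ a ∈ A, ∀ b ∈ A, a ≠ b → (a ∩ b).Finite)
    (hmad : ∀ P : Set ℕ, P.Infinite → ∃ a ∈ A, (a ∩ P).Infinite)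
    (X : ℕ → Set ℕ) (hX : Antitone X) (hpos : ∀ n, Pos A (X n)) :
    ∃ Y, Pos A Y ∧ ∀ n, (Y \ X n).Finite := by
  have hB : {a | a ∈ A ∧ ∃ P : Set ℕ, P.Infinite ∧ P ⊆ a ∧ ∀ n, (P \ X n).Finite}.Infinite := by
    intro hfin
    set B := {a | a ∈ A ∧ ∃ P : Set ℕ, P.Infinite ∧ P ⊆ a ∧ ∀ n, (P \ X n).Finite} with hBdef
    have hBA : B ⊆ A := fun a h => h.1
    obtain ⟨P, hP, hP0, hPn⟩ := pseudo_inf (fun n => X n \ ⋃₀ B)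
      (fun i j h => Set.sdiff_subset_sdiff_left (hX h)) (fun n => hpos n B hBA hfin)
    obtain ⟨a, ha, haP⟩ := hmad P hP
    have haB : a ∈ B := by
      refine ⟨ha, a ∩ P, haP, Set.inter_subset_left, fun n => (hPn n).subset ?_⟩
      rintro x ⟨h1, h2⟩
      exact ⟨h1.2, fun h => h2 h.1⟩
    obtain ⟨x, hx1, hx2⟩ := haP.nonempty
    exact (hP0 hx2).2 ⟨a, haB, hx1⟩
  let e := hB.natEmbedding
  have he : ∀ i, ∃ P : Set ℕ, P.Infinite ∧ P ⊆ (e i).1 ∧ ∀ n, (P \ X n).Finite :=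
    fun i => (e i).2.2
  choose P hP hPe hPX using he
  refine ⟨⋃ i, P i ∩ X i, ?_, ?_⟩
  · intro G hG hGf
    have : ∃ i, (e i).1 ∉ G := by
      by_contra hc
      push Not at hc
      have hinj : Function.Injective (fun i => (e i).1) :=
        Subtype.val_injective.comp e.injective
      exact Set.infinite_range_of_injective hinj
        (hGf.subset (by rintro _ ⟨i, rfl⟩; exact hc i))
    obtain ⟨i, hi⟩ := this
    have hinf : (P i ∩ X i).Infinite := by
      intro hf
      refine hP i ((hf.union (hPX i i)).subset ?_)
      intro x hx
      by_cases h : x ∈ X i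
      · exact Or.inl ⟨hx, h⟩
      · exact Or.inr ⟨hx, h⟩
    exact (diff_sUnion_infinite hAD hG hGf (e i).2.1 hi hinf
      (fun x hx => hPe i hx.1)).mono
      (Set.sdiff_subset_sdiff_left (Set.subset_iUnion (fun i => P i ∩ X i) i))
  · intro n
    refine ((Set.finite_lt_nat n).biUnion (fun i _ => hPX i n)).subset ?_
    rintro x ⟨hx, hxn⟩
    obtain ⟨i, hi1, hi2⟩ := Set.mem_iUnion.mp hx
    refine Set.mem_biUnion (x := i) ?_ ⟨hi1, hxn⟩
    by_contra hc
    exact hxn (hX (not_lt.mp hc) hi2)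

/-- Every positive set meets a member of S in an infinite set. -/
def Big (A S : Set (Set ℕ)) (X : Set ℕ) : Prop :=
  ∀ Y, Y ⊆ X → Pos A Y → ∃ b ∈ S, (b ∩ Y).Infinite

theorem decide_all {A : Set (Set ℕ)}
    (hinf : ∀ a ∈ A, a.Infinite)
    (hAD : ∀ a ∈ A, ∀ b ∈ A, a ≠ b → (a ∩ b).Finite) (hbig : A.Infinite)
    (hmad : ∀ P : Set ℕ, P.Infinite → ∃ a ∈ A, (a ∩ P).Infinite)
    (S : ℕ → Set (Set ℕ)) :
    ∃ Z, Pos A Z ∧ ∀ i, (∀ b ∈ S i, (b ∩ Z).Finite) ∨ Big A (S i) Z := by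
  have step : ∀ (i : ℕ) (X : {X // Pos A X}), ∃ Y : {X // Pos A X}, Y.1 ⊆ X.1 ∧
      ((∀ b ∈ S i, (b ∩ Y.1).Finite) ∨ Big A (S i) Y.1) := by
    rintro i ⟨X, hX⟩
    by_cases h : Big A (S i) X
    · exact ⟨⟨X, hX⟩, subset_rfl, Or.inr h⟩
    · simp only [Big, not_forall] at h
      obtain ⟨Y, hYX, hY, hn⟩ := h
      refine ⟨⟨Y, hY⟩, hYX, Or.inl fun b hb => ?_⟩
      by_contra hc
      exact hn ⟨b, hb, hc⟩
  choose f hf1 hf2 using step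
  let X : ℕ → {X // Pos A X} := fun n =>
    Nat.rec ⟨Set.univ, pos_univ hinf hAD hbig⟩ (fun i x => f i x) n
  have hXs : ∀ n, X (n + 1) = f n (X n) := fun n => rfl
  obtain ⟨Z, hZ, hZX⟩ := pseudo_pos hAD hmad (fun n => (X n).1)
    (antitone_nat_of_succ_le fun n => by rw [hXs]; exact hf1 n (X n)) (fun n => (X n).2)
  refine ⟨Z, hZ, fun i => ?_⟩
  rcases hf2 i (X i) with h | h
  · left
    intro b hb
    refine ((h b hb).union (hZX (i + 1))).subset ?_
    rintro x ⟨h1, h2⟩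
    by_cases hx : x ∈ (X (i + 1)).1
    · exact Or.inl ⟨h1, hx⟩
    · exact Or.inr ⟨h2, hx⟩
  · right
    intro Y hY hYp
    have hfin : (Y \ (X (i + 1)).1).Finite := (hZX (i + 1)).subset (Set.sdiff_subset_sdiff_left hY)
    obtain ⟨b, hb, hbi⟩ := h _ Set.inter_subset_right (hYp.almost hfin)
    exact ⟨b, hb, hbi.mono fun x hx => ⟨hx.1, hx.2.1⟩⟩

/-- Agreement below k. -/
def Agr (k : ℕ) (x y : ℕ → ℕ) : Prop := ∀ j < k, x j = y j

theorem limit_exists (w : ℕ → ℕ → ℕ) (k : ℕ → ℕ) (hk : StrictMono k)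
    (h : ∀ i, Agr (k i) (w i) (w (i + 1))) : ∃ x, ∀ i, Agr (k i) (w i) x := by
  have key : ∀ i d, Agr (k i) (w i) (w (i + d)) := by
    intro i d
    induction d with
    | zero => exact fun j _ => rfl
    | succ d ih =>
      intro j hj
      rw [ih j hj]
      exact h (i + d) j (lt_of_lt_of_le hj (hk.monotone (Nat.le_add_right i d)))
  refine ⟨fun j => w (j + 1) j, fun i j hj => ?_⟩
  rcases le_total i (j + 1) with hle | hle
  · obtain ⟨d, hd⟩ := Nat.exists_eq_add_of_le hle
    simp only [hd]
    exact key i d j hj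
  · obtain ⟨d, hd⟩ := Nat.exists_eq_add_of_le hle
    rw [hd]
    have : j + 1 ≤ k (j + 1) := hk.le_apply
    exact (key (j + 1) d j (by omega)).symm

theorem not_mad (F : (ℕ → ℕ) → Set ℕ)
    (hF : ∀ x n, ∃ k, ∀ y, Agr k x y → (n ∈ F x ↔ n ∈ F y))
    (hinf : ∀ a ∈ Set.range F, a.Infinite)
    (hAD : ∀ a ∈ Set.range F, ∀ b ∈ Set.range F, a ≠ b → (a ∩ b).Finite)
    (hbig : (Set.range F).Infinite)
    (hmad : ∀ P : Set ℕ, P.Infinite → ∃ a ∈ Set.range F, (a ∩ P).Infinite) : False := by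
  set A := Set.range F with hA
  let C : List ℕ → Set (Set ℕ) := fun l => F '' {x | (List.range l.length).map x = l}
  obtain ⟨Z, hZ, hdec⟩ := decide_all hinf hAD hbig hmad
    (fun i => ((Encodable.decode (α := List ℕ) i).elim ∅ C))
  have big : ∀ w k, (F w ∩ Z).Infinite → Big A (F '' {x | Agr k w x}) Z := by
    intro w k hw
    have hC : C ((List.range k).map w) = F '' {x | Agr k w x} := by
      simp only [C]
      congr 1
      ext x
      simp only [List.length_map, List.length_range, Set.mem_ofPred_eq, List.map_inj_left,
        List.mem_range, Agr]
      exact ⟨fun h j hj => (h j hj).symm, fun h j hj => (h j hj).symm⟩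
    have := hdec (Encodable.encode ((List.range k).map w))
    simp only [Encodable.encodek, Option.elim, hC] at this
    rcases this with h | h
    · exact absurd (h (F w) ⟨w, fun _ _ => rfl, rfl⟩) hw
    · exact h
  have step : ∀ w w' k, (F w ∩ Z).Infinite → (F w' ∩ Z).Infinite →
      ∃ n v v', k ≤ n ∧ Agr k w v ∧ Agr k w' v' ∧ (F v ∩ Z).Infinite ∧ (F v' ∩ Z).Infinite ∧
        n ∈ F v ∧ n ∈ F v' := by
    intro w w' k hw hw'
    by_contra hc
    let D : (ℕ → ℕ) → Set ℕ := fun u => {n | n ∈ Z ∧ ∀ v, Agr k u v → (F v ∩ Z).Infinite → n ∉ F v}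
    have hD : ∀ u, (F u ∩ Z).Infinite → ¬ Pos A (D u) := by
      intro u hu hp
      obtain ⟨_, ⟨v, hv, rfl⟩, hvi⟩ := big u k hu (D u) (fun n hn => hn.1) hp
      obtain ⟨n, hn1, hn2⟩ := hvi.nonempty
      exact hn2.2 v hv (hvi.mono fun x hx => ⟨hx.1, hx.2.1⟩) hn1
    have hZ' : Pos A (Z ∩ {n | k ≤ n}) := by
      refine hZ.almost ((Set.finite_lt_nat k).subset ?_)
      rintro n ⟨_, hn⟩
      simpa using hn
    have hsub : Z ∩ {n | k ≤ n} ⊆ D w ∪ D w' := by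
      rintro n ⟨hnZ, hnk⟩
      by_contra hnD
      simp only [D, Set.mem_union, Set.mem_ofPred_eq, not_or, not_and, not_forall, not_not] at hnD
      obtain ⟨v, h1, h2, h3⟩ := hnD.1 hnZ
      obtain ⟨v', h1', h2', h3'⟩ := hnD.2 hnZ
      exact hc ⟨n, v, v', hnk, h1, h1', h2, h2', h3, h3'⟩
    rcases (hZ'.mono hsub).union with h | h
    · exact hD w hw h
    · exact hD w' hw' h
  have start : ∃ w w', (F w ∩ Z).Infinite ∧ (F w' ∩ Z).Infinite ∧ F w ≠ F w' := by
    obtain ⟨_, ⟨w, rfl⟩, hw⟩ := hmad Z (by simpa using hZ ∅ (Set.empty_subset _) Set.finite_empty)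
    obtain ⟨_, ⟨w', rfl⟩, hw'⟩ := hmad (Z \ F w)
      (by simpa using hZ {F w} (by rintro _ rfl; exact ⟨w, rfl⟩) (Set.finite_singleton _))
    refine ⟨w, w', hw, hw'.mono fun x hx => ⟨hx.1, hx.2.1⟩, fun h => ?_⟩
    obtain ⟨x, hx1, hx2⟩ := hw'.nonempty
    exact hx2.2 (h ▸ hx1)
  obtain ⟨w0, w0', hw0, hw0', hne⟩ := start
  obtain ⟨m, hm⟩ : ∃ m, ¬ (m ∈ F w0 ↔ m ∈ F w0') := by
    by_contra hc
    push Not at hc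
    exact hne (Set.ext hc)
  obtain ⟨k1, hk1⟩ := hF w0 m
  obtain ⟨k2, hk2⟩ := hF w0' m
  let St := {p : (ℕ → ℕ) × (ℕ → ℕ) × ℕ // (F p.1 ∩ Z).Infinite ∧ (F p.2.1 ∩ Z).Infinite}
  have step2 : ∀ p : St, ∃ q : St, ∃ n, p.1.2.2 ≤ n ∧ p.1.2.2 < q.1.2.2 ∧
      Agr p.1.2.2 p.1.1 q.1.1 ∧ Agr p.1.2.2 p.1.2.1 q.1.2.1 ∧
      (∀ y, Agr q.1.2.2 q.1.1 y → n ∈ F y) ∧ (∀ y, Agr q.1.2.2 q.1.2.1 y → n ∈ F y) := by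
    rintro ⟨⟨w, w', k⟩, hw, hw'⟩
    obtain ⟨n, v, v', hn, h1, h2, h3, h4, h5, h6⟩ := step w w' k hw hw'
    obtain ⟨l1, hl1⟩ := hF v n
    obtain ⟨l2, hl2⟩ := hF v' n
    refine ⟨⟨⟨v, v', k + 1 + l1 + l2⟩, h3, h4⟩, n, hn, ?_, h1, h2, ?_, ?_⟩
    · show k < k + 1 + l1 + l2
      omega
    · intro y hy
      exact (hl1 y fun j hj => hy j (show j < k + 1 + l1 + l2 by omega)).mp h5
    · intro y hy
      exact (hl2 y fun j hj => hy j (show j < k + 1 + l1 + l2 by omega)).mp h6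
  choose g n hg1 hg2 hg3 hg4 hg5 hg6 using step2
  let s : ℕ → St := fun i => Nat.rec ⟨⟨w0, w0', k1 + k2⟩, hw0, hw0'⟩ (fun _ p => g p) i
  have hs : ∀ i, s (i + 1) = g (s i) := fun i => rfl
  have hmono : StrictMono (fun i => (s i).1.2.2) :=
    strictMono_nat_of_lt_succ fun i => by rw [hs]; exact hg2 (s i)
  obtain ⟨x, hx⟩ := limit_exists (fun i => (s i).1.1) (fun i => (s i).1.2.2) hmono
    (fun i => by rw [hs]; exact hg3 (s i))
  obtain ⟨x', hx'⟩ := limit_exists (fun i => (s i).1.2.1) (fun i => (s i).1.2.2) hmono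
    (fun i => by rw [hs]; exact hg4 (s i))
  have hxx : F x ≠ F x' := by
    intro h
    have e1 := hk1 x fun j hj => hx 0 j (show j < k1 + k2 by omega)
    have e2 := hk2 x' fun j hj => hx' 0 j (show j < k1 + k2 by omega)
    rw [h] at e1
    exact hm (e1.trans e2.symm)
  refine Set.infinite_of_not_bddAbove ?_ (hAD (F x) ⟨x, rfl⟩ (F x') ⟨x', rfl⟩ hxx)
  rintro ⟨M, hM⟩
  have h1 : n (s (M + 1)) ∈ F x ∩ F x' :=
    ⟨hg5 (s (M + 1)) x (hx (M + 2)), hg6 (s (M + 1)) x' (hx' (M + 2))⟩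
  have h2 := hM h1
  have h3 := hg1 (s (M + 1))
  have h4 : M + 1 ≤ (s (M + 1)).1.2.2 := hmono.le_apply (x := M + 1)
  omega

end MadAux

/-- Mathias: there is no analytic maximal almost disjoint family.
Infinite subsets of ω are coded as elements of `ℕ → Bool` (Cantor space). -/
theorem no_analytic_mad_family (A : Set (ℕ → Bool))
    (hAnalytic : MeasureTheory.AnalyticSet A)
    (hinf : ∀ f ∈ A, {n | f n = true}.Infinite)
    (hAD : ∀ f ∈ A, ∀ g ∈ A, f ≠ g → {n | f n = true ∧ g n = true}.Finite)
    (hbig : A.Infinite) :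
    ∃ h : ℕ → Bool, {n | h n = true}.Infinite ∧
      ∀ f ∈ A, {n | f n = true ∧ h n = true}.Finite := by
  classical
  by_contra hc
  rw [MeasureTheory.AnalyticSet] at hAnalytic
  rcases hAnalytic with h | ⟨φ, hφ, rfl⟩
  · exact hbig (h ▸ Set.finite_empty)
  have hsupp : Function.Injective (fun f : ℕ → Bool => {n | f n = true}) := by
    intro f g h
    funext n
    have : n ∈ {n | f n = true} ↔ n ∈ {n | g n = true} := by
      rw [show {n | f n = true} = {n | g n = true} from h]
    exact Bool.eq_iff_iff.mpr this
  refine MadAux.not_mad (fun x => {n | φ x n = true}) ?_ ?_ ?_ ?_ ?_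
  · intro x n
    have hcont : Continuous fun y => φ y n := (continuous_apply n).comp hφ
    have hopen : IsOpen {y | φ y n = φ x n} := (isOpen_discrete {φ x n}).preimage hcont
    obtain ⟨I, u, hu, hsub⟩ := isOpen_pi_iff.mp hopen x rfl
    refine ⟨I.sup id + 1, fun y hy => ?_⟩
    have : y ∈ {y | φ y n = φ x n} := by
      apply hsub
      intro i hi
      rw [← hy i (Nat.lt_succ_of_le (Finset.le_sup (f := id) hi))]
      exact (hu i hi).2
    simp only [Set.mem_ofPred_eq] at this ⊢
    rw [this]
  · rintro _ ⟨x, rfl⟩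
    exact hinf _ ⟨x, rfl⟩
  · rintro _ ⟨x, rfl⟩ _ ⟨y, rfl⟩ hne
    exact hAD _ ⟨x, rfl⟩ _ ⟨y, rfl⟩ (fun h => hne (by simp only [h]))
  · have := hbig.image hsupp.injOn
    rwa [← Set.range_comp] at this
  · intro P hP
    by_contra hn
    refine hc ⟨fun n => decide (n ∈ P), by simpa using hP, ?_⟩
    rintro _ ⟨x, rfl⟩
    by_contra hi
    refine hn ⟨_, ⟨x, rfl⟩, ?_⟩
    intro hfin
    refine hi (hfin.subset ?_)
    rintro n ⟨h1, h2⟩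
    exact ⟨h1, of_decide_eq_true h2⟩
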